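/- arXiv:1405.4948 — 3 statements merged into one kernel-verified Lean document; each statement's English description precedes it below -/
import Mathlib

section
/- Let D be a dense subset of a Hilbert space H and let (M_j, μ_{M_j}) be a measure space for each j ∈ J, J countable. Suppose ∪_{j∈J}{f_{j,k}}_{k∈M_j} and ∪_{j∈J}{g_{j,k}}_{k∈M_j} are Bessel families in H. If ⟨f, f⟩ = ∑_{j∈J} ∫_{M_j} ⟨f, f_{j,k}⟩ ⟨g_{j,k}, f⟩ dμ_{M_j}(k) holds for every f ∈ D, then ⟨f, g⟩ = ∑_{j∈J} ∫_{M_j} ⟨f, f_{j,k}⟩ ⟨g_{j,k}, g⟩ dμ_{M_j}(k) holds for all f, g ∈ H, i.e. the two families are dual frames. -/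
open MeasureTheory Complex
open scoped ENNReal ComplexConjugate InnerProductSpace

noncomputable section

/-- The union `∪_{j∈J} {f j k}_{k ∈ M j}` is a Bessel family in `H` with bound `B`:
it is weakly measurable and `∑_{j∈J} ∫_{M_j} |⟨u, f_{j,k}⟩|² dμ_{M_j}(k) ≤ B ‖u‖²`
for all `u ∈ H`. -/
def IsGBesselFamily {H : Type*} [NormedAddCommGroup H] [InnerProductSpace ℂ H]
    {J : Set ℤ} {M : J → Type*} [∀ j, MeasurableSpace (M j)]
    (μM : ∀ j, Measure (M j)) (f : ∀ j, M j → H) (B : ℝ) : Prop :=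
  (∀ (j : J) (u : H), Measurable fun k => (⟪u, f j k⟫_ℂ)) ∧
  ∀ u : H, ∑' j : J, ∫⁻ k, (‖(⟪u, f j k⟫_ℂ)‖₊ : ℝ≥0∞) ^ 2 ∂(μM j)
    ≤ ENNReal.ofReal B * (‖u‖₊ : ℝ≥0∞) ^ 2

namespace IsGBesselFamily

variable {H : Type*} [NormedAddCommGroup H] [InnerProductSpace ℂ H]
  {J : Set ℤ} {M : J → Type*} [∀ j, MeasurableSpace (M j)] {μM : ∀ j, Measure (M j)}
  {f g : ∀ j, M j → H} {A B : ℝ}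

lemma tsum_lintegral_lt_top (hf : IsGBesselFamily μM f A) (u : H) :
    ∑' j : J, ∫⁻ k, ‖⟪u, f j k⟫_ℂ‖ₑ ^ 2 ∂(μM j) < ∞ :=
  (hf.2 u).trans_lt (ENNReal.mul_lt_top ENNReal.ofReal_lt_top (by finiteness))

lemma memLp_inner (hf : IsGBesselFamily μM f A) (u : H) (j : J) :
    MemLp (fun k => ⟪u, f j k⟫_ℂ) 2 (μM j) := by
  refine ⟨(hf.1 j u).aestronglyMeasurable, ?_⟩
  rw [eLpNorm_lt_top_iff_lintegral_rpow_enorm_lt_top two_ne_zero ENNReal.ofNat_ne_top]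
  simpa using (ENNReal.le_tsum j).trans_lt (hf.tsum_lintegral_lt_top u)

lemma integrable_inner_mul_inner (hf : IsGBesselFamily μM f A) (hg : IsGBesselFamily μM g B)
    (u v : H) (j : J) : Integrable (fun k => ⟪u, f j k⟫_ℂ * ⟪g j k, v⟫_ℂ) (μM j) := by
  have h := (hf.memLp_inner u j).integrable_mul (hg.memLp_inner v j).star
  simpa [Pi.mul_def, Pi.star_def] using h

lemma tsum_enorm_integral_le (hf : IsGBesselFamily μM f A) (hg : IsGBesselFamily μM g B)
    (u v : H) : ∑' j : J, ‖∫ k, ⟪u, f j k⟫_ℂ * ⟪g j k, v⟫_ℂ ∂(μM j)‖ₑ ≤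
      ENNReal.ofReal A * ‖u‖ₑ ^ 2 + ENNReal.ofReal B * ‖v‖ₑ ^ 2 := by
  refine le_trans ?_ (add_le_add (hf.2 u) (hg.2 v))
  rw [← ENNReal.tsum_add]
  refine ENNReal.tsum_le_tsum fun j => (enorm_integral_le_lintegral_enorm _).trans ?_
  rw [← lintegral_add_left (by have := hf.1 j u; fun_prop)]
  refine lintegral_mono fun k => ?_
  have hsymm : ‖⟪g j k, v⟫_ℂ‖₊ = ‖⟪v, g j k⟫_ℂ‖₊ := NNReal.eq (norm_inner_symm _ _)
  simp only [enorm_eq_nnnorm, nnnorm_mul, hsymm]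
  norm_cast
  generalize ‖⟪u, f j k⟫_ℂ‖₊ = a
  generalize ‖⟪v, g j k⟫_ℂ‖₊ = b
  rw [← NNReal.coe_le_coe]
  push_cast
  nlinarith [sq_nonneg ((a : ℝ) - b), sq_nonneg (a : ℝ), sq_nonneg (b : ℝ)]

lemma summable_integral (hf : IsGBesselFamily μM f A) (hg : IsGBesselFamily μM g B)
    (u v : H) : Summable fun j : J => ∫ k, ⟪u, f j k⟫_ℂ * ⟪g j k, v⟫_ℂ ∂(μM j) := by
  refine .of_enorm ((hf.tsum_enorm_integral_le hg u v).trans_lt ?_).ne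
  finiteness

lemma norm_tsum_integral_le_add (hf : IsGBesselFamily μM f A) (hg : IsGBesselFamily μM g B)
    (u v : H) : ‖∑' j : J, ∫ k, ⟪u, f j k⟫_ℂ * ⟪g j k, v⟫_ℂ ∂(μM j)‖ ≤
      max A 0 * ‖u‖ ^ 2 + max B 0 * ‖v‖ ^ 2 := by
  have h := enorm_tsum_le_tsum_enorm.trans (hf.tsum_enorm_integral_le hg u v)
  have h_real := ENNReal.toReal_mono (by finiteness) h
  rwa [ENNReal.toReal_add (by finiteness) (by finiteness), ENNReal.toReal_mul,
    ENNReal.toReal_mul, ENNReal.toReal_pow, ENNReal.toReal_pow, toReal_enorm, toReal_enorm,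
    toReal_enorm, ENNReal.toReal_ofReal', ENNReal.toReal_ofReal'] at h_real

/-- The mixed frame form `(u, v) ↦ ∑_j ∫_{M_j} ⟨u, f_{j,k}⟩ ⟨g_{j,k}, v⟩ dμ_{M_j}(k)`
of two Bessel families. -/
def mixedForm (hf : IsGBesselFamily μM f A) (hg : IsGBesselFamily μM g B) :
    H →ₗ⋆[ℂ] H →ₗ[ℂ] ℂ :=
  LinearMap.mk₂'ₛₗ (starRingEnd ℂ) (RingHom.id ℂ)
    (fun u v => ∑' j : J, ∫ k, ⟪u, f j k⟫_ℂ * ⟪g j k, v⟫_ℂ ∂(μM j))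
    (fun u u' v => by
      simp_rw [inner_add_left, add_mul]
      rw [← (hf.summable_integral hg u v).tsum_add (hf.summable_integral hg u' v)]
      exact tsum_congr fun j => integral_add (hf.integrable_inner_mul_inner hg u v j)
        (hf.integrable_inner_mul_inner hg u' v j))
    (fun c u v => by
      simp_rw [inner_smul_left, mul_assoc, integral_const_mul, tsum_mul_left, smul_eq_mul])
    (fun u v v' => by
      simp_rw [inner_add_right, mul_add]
      rw [← (hf.summable_integral hg u v).tsum_add (hf.summable_integral hg u v')]
      exact tsum_congr fun j => integral_add (hf.integrable_inner_mul_inner hg u v j)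
        (hf.integrable_inner_mul_inner hg u v' j))
    (fun c u v => by
      simp_rw [inner_smul_right, mul_left_comm _ c, integral_const_mul, tsum_mul_left,
        smul_eq_mul, RingHom.id_apply])

lemma mixedForm_apply (hf : IsGBesselFamily μM f A) (hg : IsGBesselFamily μM g B) (u v : H) :
    hf.mixedForm hg u v = ∑' j : J, ∫ k, ⟪u, f j k⟫_ℂ * ⟪g j k, v⟫_ℂ ∂(μM j) := rfl

lemma norm_mixedForm_le (hf : IsGBesselFamily μM f A) (hg : IsGBesselFamily μM g B) (u v : H) :
    ‖hf.mixedForm hg u v‖ ≤ (max A 0 + max B 0) * ‖u‖ * ‖v‖ := by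
  rcases eq_or_ne u 0 with rfl | hu
  · simp
  rcases eq_or_ne v 0 with rfl | hv
  · simp
  have hu' : 0 < ‖u‖ := norm_pos_iff.2 hu
  have hv' : 0 < ‖v‖ := norm_pos_iff.2 hv
  have h := hf.norm_tsum_integral_le_add hg ((‖u‖⁻¹ : ℂ) • u) ((‖v‖⁻¹ : ℂ) • v)
  rw [← mixedForm_apply hf hg] at h
  simp only [map_smulₛₗ, LinearMap.smul_apply, norm_smul, map_inv₀, Complex.conj_ofReal,
    RingHom.id_apply, norm_inv, Complex.norm_real, norm_norm, inv_mul_cancel₀ hu'.ne',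
    inv_mul_cancel₀ hv'.ne', one_pow, mul_one] at h
  field_simp at h
  linarith

end IsGBesselFamily

/-- **Polarization**: a sesquilinear form over `ℂ` is determined by its diagonal. -/
lemma LinearMap.eq_zero_of_diag_eq_zero {E : Type*} [AddCommGroup E] [Module ℂ E]
    (T : E →ₗ⋆[ℂ] E →ₗ[ℂ] ℂ) (hT : ∀ u, T u u = 0) : T = 0 := by
  ext u v
  have h₁ := hT (u + v)
  have h₂ := hT (u + I • v)
  simp only [map_add, LinearMap.add_apply, map_smulₛₗ, LinearMap.smul_apply, hT, conj_I,
    RingHom.id_apply, smul_eq_mul] at h₁ h₂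
  simp only [LinearMap.zero_apply]
  linear_combination (1 / 2) * h₁ - (I / 2) * h₂ + (T u v - T v u) / 2 * I_sq

/-- **Lemma 2.4 (i).** If `∪_j {f j k}` and `∪_j {g j k}` are Bessel families in `H` and the
reproducing identity `⟨u, u⟩ = ∑_j ∫_{M_j} ⟨u, f_{j,k}⟩ ⟨g_{j,k}, u⟩ dμ_{M_j}(k)` holds for
all `u` in a dense subset `D` of `H`, then
`⟨u, v⟩ = ∑_j ∫_{M_j} ⟨u, f_{j,k}⟩ ⟨g_{j,k}, v⟩ dμ_{M_j}(k)` holds for all `u, v ∈ H`,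
i.e. the two families are dual frames. -/
theorem dual_frames_on_dense_subset
    {H : Type*} [NormedAddCommGroup H] [InnerProductSpace ℂ H] [CompleteSpace H]
    {J : Set ℤ} {M : J → Type*} [∀ j, MeasurableSpace (M j)] (μM : ∀ j, Measure (M j))
    (f g : ∀ j, M j → H) (D : Set H) (hD : Dense D)
    (hfB : ∃ B : ℝ, IsGBesselFamily μM f B) (hgB : ∃ B : ℝ, IsGBesselFamily μM g B)
    (h : ∀ u ∈ D, (⟪u, u⟫_ℂ) = ∑' j : J, ∫ k, (⟪u, f j k⟫_ℂ) * (⟪g j k, u⟫_ℂ) ∂(μM j)) :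
    ∀ u v : H, (⟪u, v⟫_ℂ) = ∑' j : J, ∫ k, (⟪u, f j k⟫_ℂ) * (⟪g j k, v⟫_ℂ) ∂(μM j) := by
  obtain ⟨A, hf⟩ := hfB
  obtain ⟨B, hg⟩ := hgB
  let T := (hf.mixedForm hg).mkContinuous₂ _ (hf.norm_mixedForm_le hg)
  have hdiag : (fun u => T u u) = fun u => ⟪u, u⟫_ℂ :=
    Continuous.ext_on hD (by fun_prop) (by fun_prop) fun u hu => (h u hu).symm
  have hzero := LinearMap.eq_zero_of_diag_eq_zero (hf.mixedForm hg - innerₛₗ ℂ)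
    fun u => sub_eq_zero.2 (congrFun hdiag u)
  intro u v
  exact (sub_eq_zero.1 (LinearMap.congr_fun₂ hzero u v)).symm

end
end

section
/- Let D be a dense subset of a Hilbert space H and let (M_j, μ_{M_j}) be a σ-finite measure space for each j ∈ J, J countable. Suppose ∪_{j∈J}{f_{j,k}}_{k∈M_j} is a weakly measurable family in H. If ⟨f, f⟩ = ∑_{j∈J} ∫_{M_j} |⟨f, f_{j,k}⟩|² dμ_{M_j}(k) holds for every f ∈ D, then it holds for all f ∈ H, i.e. ∪_{j∈J}{f_{j,k}}_{k∈M_j} is a Parseval frame for H. -/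
open MeasureTheory Complex
open scoped ENNReal ComplexConjugate InnerProductSpace

noncomputable section

/-- If the `L²` seminorm of the coefficients `⟪u, g x⟫` agrees with the norm of `u` on a dense set,
then it agrees with the norm everywhere. -/
theorem eLpNorm_inner_eq_enorm_of_dense
    {H : Type*} [NormedAddCommGroup H] [InnerProductSpace ℂ H]
    {X : Type*} [MeasurableSpace X] (ν : Measure X) (g : X → H)
    (hg : ∀ u : H, Measurable fun x => (⟪u, g x⟫_ℂ))
    {D : Set H} (hD : Dense D)
    (h : ∀ u ∈ D, eLpNorm (fun x => (⟪u, g x⟫_ℂ)) 2 ν = ‖u‖ₑ) (u : H) :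
    eLpNorm (fun x => (⟪u, g x⟫_ℂ)) 2 ν = ‖u‖ₑ := by
  have bessel : ∀ u : H, eLpNorm (fun x => (⟪u, g x⟫_ℂ)) 2 ν ≤ ‖u‖ₑ := by
    intro u
    obtain ⟨w, hwD, hw⟩ := mem_closure_iff_seq_limit.1 (hD u)
    have hlim : Filter.Tendsto (fun n => ‖w n‖ₑ) Filter.atTop (nhds ‖u‖ₑ) := hw.enorm
    calc eLpNorm (fun x => (⟪u, g x⟫_ℂ)) 2 ν
        ≤ Filter.liminf (fun n => eLpNorm (fun x => (⟪w n, g x⟫_ℂ)) 2 ν) Filter.atTop :=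
          Lp.eLpNorm_lim_le_liminf_eLpNorm (fun n => (hg (w n)).aestronglyMeasurable) _
            (Filter.Eventually.of_forall fun x => hw.inner tendsto_const_nhds)
      _ = ‖u‖ₑ := by
          simp_rw [fun n => h (w n) (hwD n)]
          exact hlim.liminf_eq
  refine le_antisymm (bessel u) ?_
  obtain ⟨w, hwD, hw⟩ := mem_closure_iff_seq_limit.1 (hD u)
  have hdiff : Filter.Tendsto (fun n => ‖w n - u‖ₑ) Filter.atTop (nhds 0) := by
    simpa using (hw.sub_const u).enorm
  have hbound : ∀ n, ‖w n‖ₑ ≤ eLpNorm (fun x => (⟪u, g x⟫_ℂ)) 2 ν + ‖w n - u‖ₑ := by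
    intro n
    rw [← h (w n) (hwD n)]
    have hsum : (fun x => (⟪w n, g x⟫_ℂ)) =
        (fun x => (⟪u, g x⟫_ℂ)) + fun x => (⟪w n - u, g x⟫_ℂ) := by
      funext x
      simp
    rw [hsum]
    exact (eLpNorm_add_le (hg u).aestronglyMeasurable (hg _).aestronglyMeasurable
      one_le_two).trans (by gcongr; exact bessel _)
  exact le_of_tendsto_of_tendsto' hw.enorm
    (by simpa using tendsto_const_nhds.add hdiff) hbound

/-- The disjoint union of a family of measures, as a measure on the sigma type. -/
def sigmaMeasure {ι : Type*} {M : ι → Type*} [∀ j, MeasurableSpace (M j)]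
    (μ : ∀ j, Measure (M j)) : Measure (Σ j, M j) :=
  Measure.sum fun j => (μ j).map (Sigma.mk j)

theorem measurable_sigma_of_forall {ι : Type*} {M : ι → Type*} [∀ j, MeasurableSpace (M j)]
    {β : Type*} [MeasurableSpace β] {F : (Σ j, M j) → β}
    (hF : ∀ j, Measurable fun k => F ⟨j, k⟩) : Measurable F := by
  intro s hs
  exact MeasurableSpace.measurableSet_iInf.2 fun j => hF j hs

theorem measurable_sigma_mk {ι : Type*} {M : ι → Type*} [∀ j, MeasurableSpace (M j)] (j : ι) :
    Measurable (Sigma.mk j : M j → Σ j, M j) := by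
  intro s hs
  exact MeasurableSpace.measurableSet_iInf.1 hs j

theorem lintegral_sigmaMeasure {ι : Type*} {M : ι → Type*} [∀ j, MeasurableSpace (M j)]
    (μ : ∀ j, Measure (M j)) {F : (Σ j, M j) → ℝ≥0∞} (hF : Measurable F) :
    ∫⁻ x, F x ∂(sigmaMeasure μ) = ∑' j, ∫⁻ k, F ⟨j, k⟩ ∂(μ j) := by
  rw [sigmaMeasure, lintegral_sum_measure]
  exact tsum_congr fun j => lintegral_map hF (measurable_sigma_mk j)

/-- **Lemma 2.4 (ii).** Let `D` be a dense subset of the Hilbert space `H` and let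
`(M j, μM j)` be a σ-finite measure space for each `j ∈ J ⊆ ℤ`.  If the family
`∪_{j∈J} {f j k}_{k ∈ M j}` is weakly measurable and the Parseval identity
`⟨u, u⟩ = ∑_{j∈J} ∫_{M_j} |⟨u, f_{j,k}⟩|² dμ_{M_j}(k)` holds for every `u ∈ D`, then it
holds for every `u ∈ H`, i.e. `∪_{j∈J} {f j k}` is a Parseval frame for `H`. -/
theorem parseval_frame_on_dense_subset
    {H : Type*} [NormedAddCommGroup H] [InnerProductSpace ℂ H] [CompleteSpace H]
    {J : Set ℤ} {M : J → Type*} [∀ j, MeasurableSpace (M j)]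
    (μM : ∀ j, Measure (M j)) [∀ j, SigmaFinite (μM j)]
    (f : ∀ j, M j → H)
    (hmeas : ∀ (j : J) (u : H), Measurable fun k => (⟪u, f j k⟫_ℂ))
    (D : Set H) (hD : Dense D)
    (h : ∀ u ∈ D,
      (∑' j : J, ∫⁻ k, (‖(⟪u, f j k⟫_ℂ)‖₊ : ℝ≥0∞) ^ 2 ∂(μM j)) = (‖u‖₊ : ℝ≥0∞) ^ 2) :
    ∀ u : H,
      (∑' j : J, ∫⁻ k, (‖(⟪u, f j k⟫_ℂ)‖₊ : ℝ≥0∞) ^ 2 ∂(μM j)) = (‖u‖₊ : ℝ≥0∞) ^ 2 := by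
  have hg : ∀ u : H, Measurable fun x : Σ j, M j => (⟪u, f x.1 x.2⟫_ℂ) :=
    fun u => measurable_sigma_of_forall fun j => hmeas j u
  have key : ∀ u : H, (∑' j : J, ∫⁻ k, (‖(⟪u, f j k⟫_ℂ)‖₊ : ℝ≥0∞) ^ 2 ∂(μM j)) =
      eLpNorm (fun x : Σ j, M j => (⟪u, f x.1 x.2⟫_ℂ)) 2 (sigmaMeasure μM) ^ 2 := by
    intro u
    have hpow := eLpNorm_nnreal_pow_eq_lintegral (p := 2) (μ := sigmaMeasure μM)
      (f := fun x : Σ j, M j => (⟪u, f x.1 x.2⟫_ℂ)) two_ne_zero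
    simp only [NNReal.coe_ofNat, ENNReal.coe_ofNat, ENNReal.rpow_ofNat] at hpow
    rw [hpow, lintegral_sigmaMeasure μM ((hg u).enorm.pow_const 2)]
    rfl
  intro u
  rw [key, eLpNorm_inner_eq_enorm_of_dense (sigmaMeasure μM) (fun x => f x.1 x.2) hg hD ?_ u]
  · rfl
  · intro v hv
    exact (ENNReal.pow_right_strictMono two_ne_zero).injective ((key v).symm.trans (h v hv))

end
end

section
/- Let g, h ∈ ℂ^d and a, b, d, N, M ∈ ℕ with aN = bM = d. Then the reproducing formula f = ∑_{m=0}^{M−1} ∑_{n=0}^{N−1} ⟨f, E_{mb} T_{na} g⟩ E_{mb} T_{na} h holds for all f ∈ ℂ^d if and only if ∑_{k=0}^{N−1} conj(g(x − nM − ka)) · h(x − ka) = (1/M) δ_{n,0} for all x ∈ {0, 1, …, a−1} and all n ∈ {0, 1, …, b−1}. -/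
open Complex
open scoped ComplexConjugate

noncomputable section

/-- Orthogonality of the characters `m ↦ e^{2πi m b u / d}` for `d = b M`. -/
theorem sum_range_exp_eq_ite_dvd {b d M : ℕ} [NeZero d] (hb : b * M = d) (u : ℤ) :
    ∑ m ∈ Finset.range M, Complex.exp (2 * Real.pi * Complex.I * (m * b) * u / d)
      = if (M : ℤ) ∣ u then (M : ℂ) else 0 := by
  have hd : b * M ≠ 0 := hb ▸ NeZero.ne d
  have hb0 : (b : ℂ) ≠ 0 := by exact_mod_cast left_ne_zero_of_mul hd
  have hM : M ≠ 0 := right_ne_zero_of_mul hd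
  have hM0 : (M : ℂ) ≠ 0 := by exact_mod_cast hM
  have hζ := Complex.isPrimitiveRoot_exp M hM
  set ζ := Complex.exp (2 * Real.pi * Complex.I / M) with hζ_def
  have hterm (m : ℕ) :
      Complex.exp (2 * Real.pi * Complex.I * (m * b) * u / d) = (ζ ^ u) ^ m := by
    rw [hζ_def, ← Complex.exp_int_mul, ← Complex.exp_nat_mul, ← hb]
    congr 1
    push_cast
    field_simp
  simp_rw [hterm]
  split_ifs with h
  · simp [(hζ.zpow_eq_one_iff_dvd u).2 h]
  · have h1 : ζ ^ u ≠ 1 := fun h1 => h ((hζ.zpow_eq_one_iff_dvd u).1 h1)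
    have hpow : (ζ ^ u) ^ M = 1 := by
      rw [← zpow_natCast, zpow_comm, zpow_natCast, hζ.pow_eq_one, one_zpow]
    rw [geom_sum_eq h1, hpow, sub_self, zero_div]

theorem dvd_val_sub_val_iff {b d M : ℕ} [NeZero d] (hb : b * M = d) (x y : ZMod d) :
    (M : ℤ) ∣ (x.val : ℤ) - y.val ↔ ∃ n < b, y = x - (n * M : ℕ) := by
  have hbpos : 0 < b := Nat.pos_of_ne_zero (left_ne_zero_of_mul (hb ▸ NeZero.ne d))
  have hbM : (b : ZMod d) * M = 0 := by
    rw [← Nat.cast_mul, hb, ZMod.natCast_self]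
  constructor
  · rintro ⟨c, hc⟩
    have hmod : 0 ≤ c % b := Int.emod_nonneg c (by omega)
    refine ⟨(c % b).toNat, ?_, ?_⟩
    · have := Int.emod_lt_of_pos c (b := b) (by omega)
      omega
    · have hxy := congrArg (Int.cast : ℤ → ZMod d) hc
      have hn := congrArg (Int.cast : ℤ → ZMod d) (Int.toNat_of_nonneg hmod)
      have hdiv := congrArg (Int.cast : ℤ → ZMod d) (Int.emod_add_mul_ediv c b)
      push_cast [ZMod.natCast_zmod_val] at hxy hn hdiv ⊢
      rw [hn]
      linear_combination (-1 : ZMod d) * hxy + (M : ZMod d) * hdiv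
        - ((c / b : ℤ) : ZMod d) * hbM
  · rintro ⟨n, -, rfl⟩
    set y := x - ((n * M : ℕ) : ZMod d) with hy
    have h : (((x.val : ℤ) - y.val - n * M : ℤ) : ZMod d) = 0 := by
      push_cast [ZMod.natCast_zmod_val]
      rw [hy]
      push_cast
      ring
    rw [ZMod.intCast_zmod_eq_zero_iff_dvd] at h
    have hMd : (M : ℤ) ∣ d := by exact_mod_cast Dvd.intro_left b hb
    simpa using dvd_add (hMd.trans h) (Dvd.intro_left (n : ℤ) rfl)

theorem sub_natCast_mul_eq_self_iff {b d M n : ℕ} [NeZero d] (hb : b * M = d) (hn : n < b)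
    (x : ZMod d) : x - (n * M : ℕ) = x ↔ n = 0 := by
  have hM : 0 < M := Nat.pos_of_ne_zero (right_ne_zero_of_mul (hb ▸ NeZero.ne d))
  rw [sub_eq_self, ZMod.natCast_eq_zero_iff, ← hb, Nat.mul_dvd_mul_iff_right hM]
  exact ⟨fun h => Nat.eq_zero_of_dvd_of_lt h hn, fun h => h ▸ dvd_zero b⟩

/-- A sum over the cyclic subgroup generated by `a` is invariant under translation by `a`. -/
theorem sum_range_sub_natCast_mul_mod {E : Type*} [AddCommGroup E] {a d N : ℕ} [NeZero d]
    (ha : a * N = d) (F : ZMod d → E) (x : ZMod d) :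
    ∑ k ∈ Finset.range N, F (x - (k * a : ℕ))
      = ∑ k ∈ Finset.range N, F (((x.val % a : ℕ) : ZMod d) - (k * a : ℕ)) := by
  have hstep (z : ZMod d) : ∑ k ∈ Finset.range N, F (z + a - (k * a : ℕ))
      = ∑ k ∈ Finset.range N, F (z - (k * a : ℕ)) := by
    have hend : z + a - ((N * a : ℕ) : ZMod d) = z + a - ((0 * a : ℕ) : ZMod d) := by
      rw [mul_comm N, ha]; simp
    have h := (Finset.sum_range_succ' (fun k => F (z + a - (k * a : ℕ))) N).symm.trans
      (Finset.sum_range_succ _ N)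
    rw [hend, add_left_inj] at h
    rw [← h]
    refine Finset.sum_congr rfl fun k _ => congrArg F ?_
    push_cast
    ring
  have hsteps (j : ℕ) (z : ZMod d) : ∑ k ∈ Finset.range N, F (z + (a * j : ℕ) - (k * a : ℕ))
      = ∑ k ∈ Finset.range N, F (z - (k * a : ℕ)) := by
    induction j with
    | zero => simp
    | succ j ih => rw [← ih, ← hstep (z + (a * j : ℕ)), Nat.mul_succ, Nat.cast_add, ← add_assoc]
  conv_lhs => rw [← ZMod.natCast_zmod_val x, ← Nat.mod_add_div x.val a, Nat.cast_add]
  exact hsteps _ _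

/-- The kernel of the mixed frame operator of two finite Gabor systems. -/
theorem gabor_mixed_frame_operator_apply {a b d N M : ℕ} [NeZero d] (hb : b * M = d)
    (g h f : ZMod d → ℂ) (x : ZMod d) :
    ∑ m ∈ Finset.range M, ∑ n ∈ Finset.range N,
        (∑ y : ZMod d,
            f y * conj (Complex.exp (2 * Real.pi * Complex.I * (m * b) * y.val / d)
              * g (y - (n * a : ℕ))))
          * (Complex.exp (2 * Real.pi * Complex.I * (m * b) * x.val / d)
              * h (x - (n * a : ℕ)))
      = ∑ y : ZMod d, f y * ((if (M : ℤ) ∣ (x.val : ℤ) - y.val then (M : ℂ) else 0)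
          * ∑ n ∈ Finset.range N, conj (g (y - (n * a : ℕ))) * h (x - (n * a : ℕ))) := by
  have hexp (m : ℕ) (y : ZMod d) :
      conj (Complex.exp (2 * Real.pi * Complex.I * (m * b) * y.val / d))
        * Complex.exp (2 * Real.pi * Complex.I * (m * b) * x.val / d)
      = Complex.exp (2 * Real.pi * Complex.I * (m * b) * ((x.val : ℤ) - y.val : ℤ) / d) := by
    rw [← Complex.exp_conj, ← Complex.exp_add]
    congr 1
    simp only [map_mul, map_div₀, Complex.conj_I, Complex.conj_ofReal, map_natCast, map_ofNat]
    push_cast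
    ring
  simp_rw [← sum_range_exp_eq_ite_dvd hb, ← hexp, Finset.sum_mul_sum, Finset.mul_sum,
    Finset.sum_mul]
  rw [Finset.sum_congr rfl fun m _ => Finset.sum_comm, Finset.sum_comm]
  refine Finset.sum_congr rfl fun y _ => Finset.sum_congr rfl fun m _ =>
    Finset.sum_congr rfl fun n _ => ?_
  rw [map_mul]
  ring

/-- **Example 4.6: finite, discrete Gabor systems.**  Let `g, h ∈ ℂ^d` (indexed by `ℤ/dℤ`)
and `a, b, d, N, M ∈ ℕ` with `aN = bM = d`.  With translation `(T_k g)(x) = g(x - k)` and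
modulation `(E_m g)(x) = e^{2πi m x / d} g(x)`, the reproducing formula
`f = ∑_{m=0}^{M-1} ∑_{n=0}^{N-1} ⟨f, E_{mb} T_{na} g⟩ E_{mb} T_{na} h` holds for all
`f ∈ ℂ^d` if and only if
`∑_{k=0}^{N-1} conj(g(x - nM - ka)) h(x - ka) = (1/M) δ_{n,0}` for all
`x ∈ {0, …, a-1}` and all `n ∈ {0, …, b-1}`. -/
theorem finite_gabor_dual_characterization
    (a b d N M : ℕ) [NeZero d] (ha : a * N = d) (hb : b * M = d)
    (g h : ZMod d → ℂ) :
    (∀ (f : ZMod d → ℂ) (x : ZMod d),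
        f x = ∑ m ∈ Finset.range M, ∑ n ∈ Finset.range N,
          (∑ y : ZMod d,
              f y * conj (Complex.exp (2 * Real.pi * Complex.I * (m * b) * y.val / d)
                * g (y - (n * a : ℕ))))
            * (Complex.exp (2 * Real.pi * Complex.I * (m * b) * x.val / d)
                * h (x - (n * a : ℕ))))
      ↔ (∀ x < a, ∀ n < b,
          (∑ k ∈ Finset.range N,
              conj (g ((x : ZMod d) - (n * M : ℕ) - (k * a : ℕ)))
                * h ((x : ZMod d) - (k * a : ℕ)))
            = if n = 0 then 1 / (M : ℂ) else 0) := by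
  simp_rw [gabor_mixed_frame_operator_apply hb]
  have hM : (M : ℂ) ≠ 0 := by
    exact_mod_cast right_ne_zero_of_mul (hb ▸ NeZero.ne d)
  constructor
  · intro H x _ n hn
    have hx := H (Pi.single ((x : ZMod d) - (n * M : ℕ)) 1) x
    rw [Finset.sum_eq_single ((x : ZMod d) - (n * M : ℕ))
      (fun y _ hy => by rw [Pi.single_eq_of_ne hy, zero_mul]) (by simp), Pi.single_eq_same, one_mul,
      if_pos ((dvd_val_sub_val_iff hb _ _).2 ⟨n, hn, rfl⟩), Pi.single_apply] at hx
    simp_rw [eq_comm (a := (x : ZMod d)), sub_natCast_mul_eq_self_iff hb hn] at hx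
    rw [← mul_right_inj' hM, ← hx]
    split_ifs <;> simp [hM]
  · intro H f x
    have hG (n : ℕ) (hn : n < b) : ∑ k ∈ Finset.range N,
        conj (g (x - (n * M : ℕ) - (k * a : ℕ))) * h (x - (k * a : ℕ))
          = if n = 0 then 1 / (M : ℂ) else 0 := by
      have ha0 : 0 < a := Nat.pos_of_ne_zero (left_ne_zero_of_mul (ha ▸ NeZero.ne d))
      rw [← H _ (Nat.mod_lt x.val ha0) n hn]
      simp_rw [sub_right_comm _ ((n * M : ℕ) : ZMod d)]
      exact sum_range_sub_natCast_mul_mod ha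
        (fun z => conj (g (z - (n * M : ℕ))) * h z) x
    have hb0 : 0 < b := Nat.pos_of_ne_zero (left_ne_zero_of_mul (hb ▸ NeZero.ne d))
    rw [Finset.sum_eq_single x _ (by simp)]
    · have h0 := hG 0 hb0
      simp only [zero_mul, Nat.cast_zero, sub_zero, if_true] at h0
      rw [h0, if_pos (by simp), mul_one_div_cancel hM, mul_one]
    · intro y _ hy
      split_ifs with hdvd
      · obtain ⟨n, hn, rfl⟩ := (dvd_val_sub_val_iff hb x y).1 hdvd
        rw [hG n hn, if_neg (mt (sub_natCast_mul_eq_self_iff hb hn x).2 hy)]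
        simp
      · simp

end
end
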